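/- Let τ_H be the first hitting time of 1 by a fractional Brownian motion B^H started at 0, H ∈ (1/2, 1). Then -log E[exp(-λ τ_H^{2H})] ~ √(2λ) as λ → ∞, i.e., the ratio tends to 1. -/

import Mathlib

open MeasureTheory Real ProbabilityTheory Filter
open scoped Classical

/-- `B` is a fractional Brownian motion with Hurst parameter `H` (on `[0,∞)`), started at
`0`: a centered Gaussian process whose finite linear combinations are Gaussian with variance
determined by the covariance `R_H(s,t) = (1/2)(s^{2H} + t^{2H} - |t-s|^{2H})`. -/
def IsFBM {Ω : Type*} [MeasurableSpace Ω] (P : Measure Ω)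
    (B : ℝ → Ω → ℝ) (H : ℝ) : Prop :=
  (∀ t, Measurable (B t)) ∧
  ∀ (n : ℕ) (t : Fin n → ℝ), (∀ i, 0 ≤ t i) → ∀ c : Fin n → ℝ,
    Measure.map (fun ω => ∑ i, c i * B (t i) ω) P =
      gaussianReal 0 (Real.toNNReal (∑ i, ∑ j, c i * c j *
        ((1/2) * ((t i) ^ (2*H) + (t j) ^ (2*H) - |t i - t j| ^ (2*H)))))

lemma fbm_map_eval {Ω : Type*} [MeasurableSpace Ω] {P : Measure Ω} {B : ℝ → Ω → ℝ} {H : ℝ}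
    (hH : 0 < H) (hB : IsFBM P B H) {t : ℝ} (ht : 0 ≤ t) :
    Measure.map (B t) P = gaussianReal 0 (Real.toNNReal (t ^ (2 * H))) := by
  have h := hB.2 1 (fun _ => t) (fun _ => ht) (fun _ => 1)
  have h0 : (0 : ℝ) ^ (2 * H) = 0 := Real.zero_rpow (by positivity)
  simp only [Fin.sum_univ_one, one_mul, sub_self, abs_zero, h0, sub_zero] at h
  rw [h]
  congr 2
  ring

lemma fbm_map_sub {Ω : Type*} [MeasurableSpace Ω] {P : Measure Ω} {B : ℝ → Ω → ℝ} {H : ℝ}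
    (hH : 0 < H) (hB : IsFBM P B H) {s t : ℝ} (hs : 0 ≤ s) (ht : 0 ≤ t) :
    Measure.map (fun ω => B t ω - B s ω) P
      = gaussianReal 0 (Real.toNNReal (|t - s| ^ (2 * H))) := by
  have h := hB.2 2 ![t, s] (by intro i; fin_cases i <;> simpa) ![1, -1]
  have h0 : (0 : ℝ) ^ (2 * H) = 0 := Real.zero_rpow (by positivity)
  simp only [Fin.sum_univ_two, Matrix.cons_val_zero, Matrix.cons_val_one, sub_self, abs_zero, h0,
    sub_zero, one_mul, abs_sub_comm s t] at h
  have e : (fun ω => B t ω - B s ω) = fun ω => B t ω + -1 * B s ω := by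
    funext ω; ring
  rw [e, h]
  congr 2
  ring

lemma measure_ge_le_of_map_gaussianReal {Ω : Type*} [MeasurableSpace Ω] {P : Measure Ω}
    {X : Ω → ℝ} {v V a : ℝ} (hX : Measure.map X P = gaussianReal 0 (Real.toNNReal v))
    (hv : v ≤ V) (hV : 0 ≤ V) (ha : 0 ≤ a) :
    P {ω | a ≤ X ω} ≤ ENNReal.ofReal (Real.exp (-a ^ 2 / (2 * V))) := by
  have hXm : AEMeasurable X P := aemeasurable_of_map_neZero (by rw [hX]; infer_instance)
  have hP : IsProbabilityMeasure P := by
    have : IsProbabilityMeasure (Measure.map X P) := by rw [hX]; infer_instance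
    exact Measure.isProbabilityMeasure_of_map X
  have hsub : HasSubgaussianMGF X (Real.toNNReal V) P := by
    refine ⟨fun t => ?_, fun t => ?_⟩
    · rw [← mgf_pos_iff, mgf_gaussianReal hX]
      exact Real.exp_pos _
    · rw [mgf_gaussianReal hX]
      have : ((Real.toNNReal v : NNReal) : ℝ) ≤ (Real.toNNReal V : NNReal) :=
        NNReal.coe_le_coe.2 (Real.toNNReal_le_toNNReal hv)
      rw [zero_mul, zero_add]
      gcongr
  have h := hsub.measure_ge_le ha
  rw [Real.coe_toNNReal V hV] at h
  rw [← ofReal_measureReal]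
  exact ENNReal.ofReal_le_ofReal h

lemma measure_abs_ge_le_of_map_gaussianReal {Ω : Type*} [MeasurableSpace Ω] {P : Measure Ω}
    {X : Ω → ℝ} {v V a : ℝ} (hX : Measure.map X P = gaussianReal 0 (Real.toNNReal v))
    (hv : v ≤ V) (hV : 0 ≤ V) (ha : 0 ≤ a) :
    P {ω | a ≤ |X ω|} ≤ 2 * ENNReal.ofReal (Real.exp (-a ^ 2 / (2 * V))) := by
  have hXm : AEMeasurable X P := aemeasurable_of_map_neZero (by rw [hX]; infer_instance)
  have hX' : Measure.map (fun ω => -X ω) P = gaussianReal 0 (Real.toNNReal v) := by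
    have : (fun ω => -X ω) = (fun x : ℝ => -x) ∘ X := rfl
    rw [this, ← AEMeasurable.map_map_of_aemeasurable (by fun_prop) hXm, hX, gaussianReal_map_neg,
      neg_zero]
  have hsub : {ω | a ≤ |X ω|} ⊆ {ω | a ≤ X ω} ∪ {ω | a ≤ -X ω} := by
    intro ω hω
    simpa [le_abs] using hω
  calc P {ω | a ≤ |X ω|} ≤ P {ω | a ≤ X ω} + P {ω | a ≤ -X ω} :=
        (measure_mono hsub).trans (measure_union_le _ _)
    _ ≤ _ := by
        rw [two_mul]
        exact add_le_add (measure_ge_le_of_map_gaussianReal hX hv hV ha)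
          (measure_ge_le_of_map_gaussianReal hX' hv hV ha)

lemma le_measure_ge_of_map_gaussianReal {Ω : Type*} [MeasurableSpace Ω] {P : Measure Ω}
    {X : Ω → ℝ} {v : ℝ} (hXm : Measurable X)
    (hX : Measure.map X P = gaussianReal 0 (Real.toNNReal v)) (hv : 0 < v) :
    (Real.sqrt (2 * π))⁻¹ * Real.exp (-((Real.sqrt v)⁻¹ + 1) ^ 2 / 2) ≤ P.real {ω | 1 ≤ X ω} := by
  have hsv : 0 < Real.sqrt v := Real.sqrt_pos.2 hv
  have hP : P.real {ω | 1 ≤ X ω} = (gaussianReal 0 (Real.toNNReal v)).real (Set.Ici 1) := by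
    rw [← hX, map_measureReal_apply hXm measurableSet_Ici]
    rfl
  have hv' : Real.toNNReal v ≠ 0 := by simpa using hv
  rw [hP, measureReal_def, gaussianReal_apply_eq_integral 0 hv',
    ENNReal.toReal_ofReal (integral_nonneg fun x => gaussianPDFReal_nonneg _ _ _)]
  have h1 : ∫ x in Set.Icc 1 (1 + Real.sqrt v),
      (Real.sqrt (2 * π))⁻¹ * (Real.sqrt v)⁻¹ * Real.exp (-((Real.sqrt v)⁻¹ + 1) ^ 2 / 2)
      ≤ ∫ x in Set.Icc 1 (1 + Real.sqrt v), gaussianPDFReal 0 (Real.toNNReal v) x := by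
    refine setIntegral_mono_on (integrableOn_const (by simp))
      (integrable_gaussianPDFReal _ _).integrableOn measurableSet_Icc ?_
    intro x hx
    rw [gaussianPDFReal_def, Real.coe_toNNReal v hv.le, Real.sqrt_mul (by positivity) v, mul_inv]
    refine mul_le_mul_of_nonneg_left (Real.exp_le_exp.2 ?_) (by positivity)
    rw [sub_zero, neg_div, neg_div, neg_le_neg_iff]
    have : x ^ 2 ≤ (1 + Real.sqrt v) ^ 2 := by
      have := hx.2
      have := hx.1
      gcongr
    have e : ((Real.sqrt v)⁻¹ + 1) ^ 2 / 2 = (1 + Real.sqrt v) ^ 2 / (2 * v) := by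
      nth_rewrite 3 [← Real.sq_sqrt hv.le]
      field_simp
    rw [e]
    gcongr
  have h2 : ∫ x in Set.Icc 1 (1 + Real.sqrt v), gaussianPDFReal 0 (Real.toNNReal v) x
      ≤ ∫ x in Set.Ici 1, gaussianPDFReal 0 (Real.toNNReal v) x := by
    refine setIntegral_mono_set (integrable_gaussianPDFReal _ _).integrableOn
      (ae_of_all _ fun x => gaussianPDFReal_nonneg _ _ _) ?_
    exact (Set.Icc_subset_Ici_self).eventuallyLE
  refine le_trans (le_of_eq ?_) (h1.trans h2)
  rw [setIntegral_const, Real.volume_real_Icc_of_le (by linarith), smul_eq_mul]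
  field_simp
  ring

lemma lt_one_of_dyadic_bounds {f : ℝ → ℝ} {t : ℝ} (ht : 0 ≤ t)
    (hf : ContinuousOn f (Set.Ici 0)) (m : ℕ)
    (h0 : ∀ i ∈ Finset.range (2 ^ m + 1), f (t * (i / 2 ^ m)) < 1 - 3 * (3 / 4) ^ m)
    (h1 : ∀ k, ∀ i ∈ Finset.range (2 ^ k),
      |f (t * ((i + 1 : ℕ) / 2 ^ k)) - f (t * (i / 2 ^ k))| < (3 / 4) ^ k)
    {s : ℝ} (hs : s ∈ Set.Icc 0 t) : f s < 1 := by
  obtain ⟨u, hu, rfl⟩ : ∃ u ∈ Set.Icc (0 : ℝ) 1, t * u = s := by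
    rcases ht.eq_or_lt with rfl | ht
    · exact ⟨0, by simp, by simpa using (le_antisymm hs.2 hs.1).symm⟩
    · exact ⟨s / t, ⟨div_nonneg hs.1 ht.le, (div_le_one ht).2 hs.2⟩, by field_simp⟩
  have hu0 := hu.1
  have hu1 := hu.2
  set N : ℕ → ℕ := fun k => ⌊2 ^ k * u⌋₊ with hN
  set x : ℕ → ℝ := fun k => t * (N k / 2 ^ k) with hx
  have hlo : ∀ k, (N k : ℝ) ≤ 2 ^ k * u := fun k => Nat.floor_le (by positivity)
  have hhi : ∀ k, 2 ^ k * u < N k + 1 := fun k => Nat.lt_floor_add_one _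
  have hNle : ∀ k, N k ≤ 2 ^ k := fun k => by
    have h : (N k : ℝ) ≤ 2 ^ k := (hlo k).trans (mul_le_of_le_one_right (by positivity) hu1)
    exact_mod_cast h
  have hstep : ∀ k, f (x (k + 1)) ≤ f (x k) + (3 / 4) ^ (k + 1) := by
    intro k
    have h2 : 2 * N k ≤ N (k + 1) := by
      refine Nat.le_floor ?_
      push_cast
      have := hlo k
      rw [pow_succ]
      linarith
    have h3 : N (k + 1) < 2 * N k + 2 := by
      have h4 := hlo (k + 1)
      have h5 := hhi k
      rw [pow_succ] at h4
      have : (N (k + 1) : ℝ) < 2 * N k + 2 := by linarith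
      exact_mod_cast this
    have hxk : x k = t * ((2 * N k : ℕ) / 2 ^ (k + 1)) := by
      simp only [hx]
      push_cast
      rw [pow_succ]
      field_simp
    rcases (by omega : N (k + 1) = 2 * N k ∨ N (k + 1) = 2 * N k + 1) with h | h
    · rw [hxk, ← h]
      have : (0 : ℝ) ≤ (3 / 4) ^ (k + 1) := by positivity
      simp only [hx]
      linarith
    · have h6 := h1 (k + 1) (2 * N k) (by
        have := hNle (k + 1)
        simp only [Finset.mem_range]
        omega)
      rw [← h, ← hxk] at h6
      have := (abs_lt.1 h6).2
      simp only [hx] at this ⊢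
      linarith
  have hmono : Antitone fun k => f (x k) + 3 * (3 / 4 : ℝ) ^ k := by
    refine antitone_nat_of_succ_le fun k => ?_
    have := hstep k
    simp only [pow_succ] at this ⊢
    linarith
  have hxlim : Tendsto x atTop (nhds (t * u)) := by
    refine Tendsto.const_mul t ?_
    have hz : Tendsto (fun k : ℕ => u - (1 / 2 : ℝ) ^ k) atTop (nhds (u - 0)) :=
      tendsto_const_nhds.sub (tendsto_pow_atTop_nhds_zero_of_lt_one (by norm_num) (by norm_num))
    rw [sub_zero] at hz
    refine tendsto_of_tendsto_of_tendsto_of_le_of_le hz tendsto_const_nhds (fun k => ?_)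
      (fun k => ?_)
    · have := hhi k
      rw [one_div, inv_pow, sub_le_iff_le_add, inv_eq_one_div, ← add_div, le_div_iff₀ (by positivity)]
      linarith
    · rw [div_le_iff₀ (by positivity)]
      have := hlo k
      linarith
  have hx0 : ∀ k, x k ∈ Set.Ici (0 : ℝ) := fun k => by
    simp only [hx, Set.mem_Ici]
    positivity
  have hflim : Tendsto (fun k => f (x k)) atTop (nhds (f (t * u))) :=
    ((hf (t * u) hs.1).tendsto).comp
      (tendsto_nhdsWithin_iff.2 ⟨hxlim, Eventually.of_forall hx0⟩)
  have hle : f (t * u) ≤ f (x m) + 3 * (3 / 4) ^ m := by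
    refine le_of_tendsto hflim ((eventually_ge_atTop m).mono fun k hk => ?_)
    have h7 := hmono hk
    have : (0 : ℝ) ≤ 3 * (3 / 4) ^ k := by positivity
    simp only at h7
    linarith
  have := h0 (N m) (by simpa [Nat.lt_succ_iff] using hNle m)
  simp only [hx] at hle
  linarith

lemma measurableSet_exists_Icc_eq {Ω : Type*} [MeasurableSpace Ω] {B : ℝ → Ω → ℝ}
    (hB : ∀ t, Measurable (B t)) (hcont : ∀ ω, ContinuousOn (fun t => B t ω) (Set.Ici 0))
    {t : ℝ} (ht : 0 ≤ t) (c : ℝ) : MeasurableSet {ω | ∃ s ∈ Set.Icc 0 t, B s ω = c} := by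
  have hne : Nonempty (Set.Icc (0 : ℝ) t) := ⟨⟨0, by simp [ht]⟩⟩
  have hset : {ω | ∃ s ∈ Set.Icc 0 t, B s ω = c} = ⋂ n : ℕ, ⋃ k : ℕ,
      {ω | |B (TopologicalSpace.denseSeq (Set.Icc (0 : ℝ) t) k) ω - c| < 1 / ((n : ℝ) + 1)} := by
    ext ω
    simp only [Set.mem_ofPred_eq, Set.mem_iInter, Set.mem_iUnion]
    have hg : Continuous fun s : Set.Icc (0 : ℝ) t => |B s ω - c| := by
      have h : Continuous fun s : Set.Icc (0 : ℝ) t => B s ω :=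
        continuousOn_iff_continuous_domRestrict.1 ((hcont ω).mono fun s hs => hs.1)
      exact (h.sub continuous_const).abs
    constructor
    · rintro ⟨s, hs, hsc⟩ n
      obtain ⟨k, hk⟩ := (TopologicalSpace.denseRange_denseSeq (Set.Icc (0 : ℝ) t)).exists_mem_open
        (isOpen_lt hg continuous_const) ⟨(⟨s, hs⟩ : Set.Icc (0 : ℝ) t), by
          show |B s ω - c| < 1 / ((n : ℝ) + 1)
          rw [hsc, sub_self, abs_zero]
          positivity⟩
      exact ⟨k, hk⟩
    · intro h
      obtain ⟨s, -, hs⟩ := isCompact_univ.exists_isMinOn Set.univ_nonempty hg.continuousOn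
      refine ⟨s, s.2, ?_⟩
      by_contra hne
      obtain ⟨n, hn⟩ := exists_nat_one_div_lt (abs_pos.2 (sub_ne_zero.2 hne))
      obtain ⟨k, hk⟩ := h n
      have := hs (Set.mem_univ (TopologicalSpace.denseSeq (Set.Icc (0 : ℝ) t) k))
      simp only [Set.mem_ofPred_eq] at this
      linarith
  rw [hset]
  refine MeasurableSet.iInter fun n => MeasurableSet.iUnion fun k => ?_
  have := hB (TopologicalSpace.denseSeq (Set.Icc (0 : ℝ) t) k)
  exact measurableSet_lt (by fun_prop) measurable_const

lemma summable_two_pow_mul_exp_neg_pow :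
    Summable fun k : ℕ => (2 : ℝ) ^ (k + 1) * Real.exp (-((9 / 8 : ℝ) ^ k - 1) / 2) := by
  have hgeo : Summable fun k : ℕ =>
      (2 * Real.exp (1 / 2) * (Nat.factorial 7 * 2 ^ 7)) * (2 * (8 / 9) ^ 7 : ℝ) ^ k :=
    (summable_geometric_of_lt_one (by norm_num) (by norm_num)).mul_left _
  refine Summable.of_nonneg_of_le (fun k => by positivity) (fun k => ?_) hgeo
  have hy : (0 : ℝ) < (9 / 8) ^ k := by positivity
  have h := Real.pow_div_factorial_le_exp (x := (9 / 8 : ℝ) ^ k / 2) (by positivity) 7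
  have h2 : Real.exp (-((9 / 8 : ℝ) ^ k / 2)) ≤
      (Nat.factorial 7 * 2 ^ 7) * ((8 / 9) ^ 7 : ℝ) ^ k := by
    rw [Real.exp_neg]
    refine (inv_anti₀ (by positivity) h).trans (le_of_eq ?_)
    have e : (8 / 9 : ℝ) = (9 / 8)⁻¹ := by norm_num
    rw [e, inv_pow, inv_pow, pow_right_comm]
    field_simp
  have h3 : Real.exp (-((9 / 8 : ℝ) ^ k - 1) / 2)
      = Real.exp (1 / 2) * Real.exp (-((9 / 8 : ℝ) ^ k / 2)) := by
    rw [← Real.exp_add]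
    congr 1
    ring
  rw [h3, mul_pow, pow_succ]
  calc (2 : ℝ) ^ k * 2 * (Real.exp (1 / 2) * Real.exp (-((9 / 8 : ℝ) ^ k / 2)))
      ≤ (2 : ℝ) ^ k * 2 * (Real.exp (1 / 2) *
        ((Nat.factorial 7 * 2 ^ 7) * ((8 / 9) ^ 7 : ℝ) ^ k)) := by gcongr
    _ = _ := by ring

lemma fbm_measure_grid_le {Ω : Type*} [MeasurableSpace Ω] {P : Measure Ω} {B : ℝ → Ω → ℝ} {H : ℝ}
    (hH : 1 / 2 < H) (hB : IsFBM P B H) {t : ℝ} (ht : 0 < t) {m i : ℕ}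
    (hi : i ∈ Finset.range (2 ^ m + 1)) {a : ℝ} (ha : 0 ≤ a) :
    P {ω | a ≤ B (t * (i / 2 ^ m)) ω}
      ≤ ENNReal.ofReal (Real.exp (-a ^ 2 / (2 * t ^ (2 * H)))) := by
  refine measure_ge_le_of_map_gaussianReal (fbm_map_eval (by linarith) hB (by positivity)) ?_
    (by positivity) ha
  refine Real.rpow_le_rpow (by positivity) ?_ (by linarith)
  refine mul_le_of_le_one_right ht.le ((div_le_one (by positivity)).2 ?_)
  have : i ≤ 2 ^ m := by simpa [Nat.lt_succ_iff] using hi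
  exact_mod_cast this

lemma fbm_measure_increment_le {Ω : Type*} [MeasurableSpace Ω] {P : Measure Ω} {B : ℝ → Ω → ℝ}
    {H : ℝ} (hH : 1 / 2 < H) (hB : IsFBM P B H) {t : ℝ} (ht : 0 < t) (ht1 : t ^ (2 * H) ≤ 1)
    (k i : ℕ) :
    P {ω | (3 / 4) ^ k ≤ |B (t * ((i + 1 : ℕ) / 2 ^ k)) ω - B (t * (i / 2 ^ k)) ω|}
      ≤ 2 * (ENNReal.ofReal (Real.exp (-((9 / 8 : ℝ) ^ k - 1) / 2))
        * ENNReal.ofReal (Real.exp (-1 / (2 * t ^ (2 * H))))) := by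
  have hε : 0 < t ^ (2 * H) := by positivity
  have hV : |t * ((i + 1 : ℕ) / 2 ^ k) - t * (i / 2 ^ k)| ^ (2 * H) ≤ t ^ (2 * H) / 2 ^ k := by
    have e : t * ((i + 1 : ℕ) / 2 ^ k) - t * (i / 2 ^ k) = t * (2 ^ k)⁻¹ := by
      push_cast
      ring
    rw [e, abs_of_pos (by positivity), Real.mul_rpow ht.le (by positivity), div_eq_mul_inv]
    gcongr
    have h1 : ((2 : ℝ) ^ k)⁻¹ ≤ 1 := inv_le_one_of_one_le₀ (one_le_pow₀ (by norm_num))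
    exact (Real.rpow_le_rpow_of_exponent_ge (by positivity) h1 (by linarith : 1 ≤ 2 * H)).trans_eq
      (Real.rpow_one _)
  refine (measure_abs_ge_le_of_map_gaussianReal
    (fbm_map_sub (by linarith) hB (by positivity) (by positivity)) hV (by positivity)
    (by positivity)).trans ?_
  rw [← ENNReal.ofReal_mul (by positivity), ← Real.exp_add]
  gcongr
  have hy : (1 : ℝ) ≤ (9 / 8) ^ k := one_le_pow₀ (by norm_num)
  have e : -((3 / 4 : ℝ) ^ k) ^ 2 / (2 * (t ^ (2 * H) / 2 ^ k))
      = -((9 / 8 : ℝ) ^ k - 1) / (2 * t ^ (2 * H)) + -1 / (2 * t ^ (2 * H)) := by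
    have h98 : (9 / 8 : ℝ) ^ k = ((3 / 4 : ℝ) ^ k) ^ 2 * 2 ^ k := by
      rw [← pow_mul, mul_comm k 2, pow_mul, ← mul_pow]
      norm_num
    rw [h98]
    field_simp
    ring
  rw [e]
  gcongr ?_ + _
  rw [neg_div, neg_div, neg_le_neg_iff]
  exact div_le_div_of_nonneg_left (by linarith) (by positivity) (by linarith)

lemma fbm_exists_measure_hit_le {Ω : Type*} [MeasurableSpace Ω] {P : Measure Ω} {B : ℝ → Ω → ℝ}
    {H : ℝ} (hH : 1 / 2 < H) (hB : IsFBM P B H)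
    (hcont : ∀ ω, ContinuousOn (fun t => B t ω) (Set.Ici 0)) {m : ℕ}
    (hm : 3 * (3 / 4 : ℝ) ^ m ≤ 1) :
    ∃ C : ENNReal, C ≠ ⊤ ∧ ∀ t : ℝ, 0 < t → t ^ (2 * H) ≤ 1 →
      P {ω | ∃ s ∈ Set.Icc 0 t, B s ω = 1} ≤
        C * ENNReal.ofReal (Real.exp (-(1 - 3 * (3 / 4) ^ m) ^ 2 / (2 * t ^ (2 * H)))) := by
  set δ : ℝ := 3 * (3 / 4) ^ m with hδ
  have hδ0 : 0 < δ := by positivity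
  refine ⟨(2 ^ m + 1 : ℕ) +
    ∑' k : ℕ, ENNReal.ofReal ((2 : ℝ) ^ (k + 1) * Real.exp (-((9 / 8 : ℝ) ^ k - 1) / 2)),
    ENNReal.add_ne_top.2 ⟨ENNReal.natCast_ne_top _,
      summable_two_pow_mul_exp_neg_pow.tsum_ofReal_ne_top⟩, fun t ht ht1 => ?_⟩
  have hε : 0 < t ^ (2 * H) := by positivity
  set G := ENNReal.ofReal (Real.exp (-(1 - δ) ^ 2 / (2 * t ^ (2 * H)))) with hG
  have hsub : {ω | ∃ s ∈ Set.Icc 0 t, B s ω = 1} ⊆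
      (⋃ i ∈ Finset.range (2 ^ m + 1), {ω | 1 - δ ≤ B (t * (i / 2 ^ m)) ω}) ∪
      ⋃ k : ℕ, ⋃ i ∈ Finset.range (2 ^ k),
        {ω | (3 / 4) ^ k ≤ |B (t * ((i + 1 : ℕ) / 2 ^ k)) ω - B (t * (i / 2 ^ k)) ω|} := by
    intro ω hω
    obtain ⟨s, hs, hs1⟩ := hω
    by_contra hnot
    simp only [Set.mem_union, Set.mem_iUnion, Set.mem_ofPred_eq, not_or, not_exists, not_le] at hnot
    exact (lt_one_of_dyadic_bounds ht.le (hcont ω) m hnot.1 hnot.2 hs).ne hs1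
  have h1 : P (⋃ i ∈ Finset.range (2 ^ m + 1), {ω | 1 - δ ≤ B (t * (i / 2 ^ m)) ω})
      ≤ (2 ^ m + 1 : ℕ) * G := by
    refine (measure_biUnion_finset_le _ _).trans ?_
    refine (Finset.sum_le_card_nsmul _ _ G fun i hi => ?_).trans ?_
    · exact fbm_measure_grid_le hH hB ht hi (by linarith)
    · rw [Finset.card_range, nsmul_eq_mul]
  have hG1 : ENNReal.ofReal (Real.exp (-1 / (2 * t ^ (2 * H)))) ≤ G := by
    refine ENNReal.ofReal_le_ofReal (Real.exp_le_exp.2 ?_)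
    gcongr
    nlinarith
  have h2 : P (⋃ k : ℕ, ⋃ i ∈ Finset.range (2 ^ k),
      {ω | (3 / 4) ^ k ≤ |B (t * ((i + 1 : ℕ) / 2 ^ k)) ω - B (t * (i / 2 ^ k)) ω|}) ≤
      (∑' k : ℕ, ENNReal.ofReal
        ((2 : ℝ) ^ (k + 1) * Real.exp (-((9 / 8 : ℝ) ^ k - 1) / 2))) * G := by
    rw [← ENNReal.tsum_mul_right]
    refine (measure_iUnion_le _).trans (ENNReal.tsum_le_tsum fun k => ?_)
    refine (measure_biUnion_finset_le _ _).trans ?_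
    refine (Finset.sum_le_card_nsmul _ _ _ fun i hi =>
      fbm_measure_increment_le hH hB ht ht1 k i).trans ?_
    rw [Finset.card_range, nsmul_eq_mul, ENNReal.ofReal_mul (by positivity),
      ENNReal.ofReal_pow (by norm_num), pow_succ]
    push_cast
    rw [ENNReal.ofReal_ofNat, ← mul_assoc, ← mul_assoc]
    gcongr
  refine (measure_mono hsub).trans ((measure_union_le _ _).trans ?_)
  rw [add_mul]
  exact add_le_add h1 h2

lemma fbm_exists_measure_hit_nat_le {Ω : Type*} [MeasurableSpace Ω] {P : Measure Ω}
    [IsProbabilityMeasure P] {B : ℝ → Ω → ℝ}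
    {H : ℝ} (hH : 1 / 2 < H) (hB : IsFBM P B H)
    (hcont : ∀ ω, ContinuousOn (fun t => B t ω) (Set.Ici 0)) {r : ℝ} (hr0 : 0 ≤ r) (hr : r < 1) :
    ∃ C : ENNReal, C ≠ ⊤ ∧ ∀ j : ℕ,
      P {ω | ∃ s : ℝ, 0 ≤ s ∧ j * s ^ (2 * H) ≤ 1 ∧ B s ω = 1} ≤
        C * ENNReal.ofReal (Real.exp (-(r ^ 2 / 2) * j)) := by
  obtain ⟨m, hm⟩ := exists_pow_lt_of_lt_one (show 0 < (1 - r) / 3 by linarith)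
    (show (3 / 4 : ℝ) < 1 by norm_num)
  obtain ⟨C, hC, hle⟩ := fbm_exists_measure_hit_le hH hB hcont (m := m) (by linarith)
  refine ⟨C + 1, ENNReal.add_ne_top.2 ⟨hC, ENNReal.one_ne_top⟩, fun j => ?_⟩
  rcases j.eq_zero_or_pos with rfl | hj
  · simpa using prob_le_one.trans (le_add_self : (1 : ENNReal) ≤ C + 1)
  have hj' : (0 : ℝ) < j := by exact_mod_cast hj
  set t : ℝ := ((j : ℝ)⁻¹) ^ ((2 * H)⁻¹) with ht
  have ht0 : 0 < t := by positivity
  have htH : t ^ (2 * H) = (j : ℝ)⁻¹ := Real.rpow_inv_rpow (by positivity) (by positivity)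
  have h1 : t ^ (2 * H) ≤ 1 := by
    rw [htH]
    exact inv_le_one_of_one_le₀ (by exact_mod_cast hj)
  have hsub : {ω | ∃ s : ℝ, 0 ≤ s ∧ j * s ^ (2 * H) ≤ 1 ∧ B s ω = 1} ⊆
      {ω | ∃ s ∈ Set.Icc 0 t, B s ω = 1} := by
    rintro ω ⟨s, hs, hjs, hsB⟩
    refine ⟨s, ⟨hs, ?_⟩, hsB⟩
    rw [← Real.rpow_le_rpow_iff hs ht0.le (show 0 < 2 * H by linarith), htH,
      ← one_div, le_div_iff₀' hj']
    exact hjs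
  refine (measure_mono hsub).trans ((hle t ht0 h1).trans ?_)
  gcongr
  · exact le_self_add
  · rw [htH]
    have e : -(1 - 3 * (3 / 4 : ℝ) ^ m) ^ 2 / (2 * (j : ℝ)⁻¹)
      = -((1 - 3 * (3 / 4 : ℝ) ^ m) ^ 2 / 2) * j := by
      field_simp
    rw [e]
    gcongr
    linarith

lemma hittingTime_spec {f : ℝ → ℝ} (hf : ContinuousOn f (Set.Ici 0))
    (hne : {t : ℝ | 0 ≤ t ∧ f t = 1}.Nonempty) :
    0 ≤ sInf {t : ℝ | 0 ≤ t ∧ f t = 1} ∧ f (sInf {t : ℝ | 0 ≤ t ∧ f t = 1}) = 1 := by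
  have hcl : IsClosed {t : ℝ | 0 ≤ t ∧ f t = 1} :=
    hf.preimage_isClosed_of_isClosed isClosed_Ici (isClosed_singleton (x := (1 : ℝ)))
  exact hcl.csInf_mem hne ⟨0, fun t ht => ht.1⟩

lemma hittingTime_le {f : ℝ → ℝ} {t : ℝ} (ht : 0 ≤ t) (hft : f t = 1) :
    sInf {t : ℝ | 0 ≤ t ∧ f t = 1} ≤ t :=
  csInf_le ⟨0, fun _ hs => hs.1⟩ ⟨ht, hft⟩

lemma measurable_laplace_hittingTime {Ω : Type*} [MeasurableSpace Ω] {B : ℝ → Ω → ℝ} {p : ℝ}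
    (hB : ∀ t, Measurable (B t)) (hcont : ∀ ω, ContinuousOn (fun t => B t ω) (Set.Ici 0))
    (lam : ℝ) :
    Measurable fun ω => if ({t : ℝ | 0 ≤ t ∧ B t ω = 1}).Nonempty
      then Real.exp (-lam * (sInf {t : ℝ | 0 ≤ t ∧ B t ω = 1}) ^ p) else 0 := by
  have hN : MeasurableSet {ω | ({t : ℝ | 0 ≤ t ∧ B t ω = 1}).Nonempty} := by
    have : {ω | ({t : ℝ | 0 ≤ t ∧ B t ω = 1}).Nonempty}
        = ⋃ n : ℕ, {ω | ∃ s ∈ Set.Icc (0 : ℝ) n, B s ω = 1} := by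
      ext ω
      simp only [Set.mem_iUnion, Set.mem_ofPred_eq]
      constructor
      · rintro ⟨s, hs, hsB⟩
        obtain ⟨n, hn⟩ := exists_nat_ge s
        exact ⟨n, s, ⟨hs, hn⟩, hsB⟩
      · rintro ⟨n, s, hs, hsB⟩
        exact ⟨s, hs.1, hsB⟩
    rw [this]
    exact MeasurableSet.iUnion fun n => measurableSet_exists_Icc_eq hB hcont n.cast_nonneg 1
  have hT : Measurable fun ω => sInf {t : ℝ | 0 ≤ t ∧ B t ω = 1} := by
    refine measurable_of_Iic fun t => ?_
    rcases lt_or_ge t 0 with ht | ht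
    · have : (fun ω => sInf {t : ℝ | 0 ≤ t ∧ B t ω = 1}) ⁻¹' Set.Iic t = ∅ := by
        refine Set.eq_empty_of_forall_notMem fun ω hω => ?_
        have h0 : 0 ≤ sInf {t : ℝ | 0 ≤ t ∧ B t ω = 1} := Real.sInf_nonneg fun s hs => hs.1
        have h1 : sInf {t : ℝ | 0 ≤ t ∧ B t ω = 1} ≤ t := hω
        linarith
      rw [this]
      exact MeasurableSet.empty
    · have : (fun ω => sInf {t : ℝ | 0 ≤ t ∧ B t ω = 1}) ⁻¹' Set.Iic t
          = {ω | ({t : ℝ | 0 ≤ t ∧ B t ω = 1}).Nonempty}ᶜ ∪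
            {ω | ∃ s ∈ Set.Icc (0 : ℝ) t, B s ω = 1} := by
        ext ω
        simp only [Set.mem_preimage, Set.mem_Iic, Set.mem_union, Set.mem_compl_iff,
          Set.mem_ofPred_eq]
        constructor
        · intro h
          by_cases hne : ({t : ℝ | 0 ≤ t ∧ B t ω = 1}).Nonempty
          · have hs := hittingTime_spec (hcont ω) hne
            exact Or.inr ⟨_, ⟨hs.1, h⟩, hs.2⟩
          · exact Or.inl hne
        · rintro (h | ⟨s, hs, hsB⟩)
          · rw [Set.not_nonempty_iff_eq_empty.1 h, Real.sInf_empty]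
            exact ht
          · exact (hittingTime_le (f := fun t => B t ω) hs.1 hsB).trans hs.2
      rw [this]
      exact hN.compl.union (measurableSet_exists_Icc_eq hB hcont ht 1)
  exact Measurable.ite hN (by fun_prop) measurable_const

lemma integrable_laplace_hittingTime {Ω : Type*} [MeasurableSpace Ω] {P : Measure Ω}
    [IsFiniteMeasure P] {B : ℝ → Ω → ℝ} {p : ℝ}
    (hB : ∀ t, Measurable (B t)) (hcont : ∀ ω, ContinuousOn (fun t => B t ω) (Set.Ici 0))
    {lam : ℝ} (hlam : 0 ≤ lam) :
    Integrable (fun ω => if ({t : ℝ | 0 ≤ t ∧ B t ω = 1}).Nonempty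
      then Real.exp (-lam * (sInf {t : ℝ | 0 ≤ t ∧ B t ω = 1}) ^ p) else 0) P := by
  refine Integrable.of_bound (measurable_laplace_hittingTime hB hcont lam).aestronglyMeasurable 1
    (ae_of_all _ fun ω => ?_)
  split_ifs
  · rw [Real.norm_eq_abs, Real.abs_exp, Real.exp_le_one_iff, neg_mul, neg_nonpos]
    exact mul_nonneg hlam (Real.rpow_nonneg (Real.sInf_nonneg fun s hs => hs.1) _)
  · simp

lemma fbm_zero_ae {Ω : Type*} [MeasurableSpace Ω] {P : Measure Ω} {B : ℝ → Ω → ℝ} {H : ℝ}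
    (hH : 0 < H) (hB : IsFBM P B H) : ∀ᵐ ω ∂P, B 0 ω = 0 := by
  have h := fbm_map_eval hH hB le_rfl
  rw [Real.zero_rpow (by positivity), Real.toNNReal_zero, gaussianReal_zero_var] at h
  have h2 : ∀ᵐ x ∂(Measure.map (B 0) P), x = 0 := by
    rw [h, ae_dirac_eq]
    simp
  exact ae_of_ae_map (hB.1 0).aemeasurable h2

lemma fbm_le_laplace_hittingTime {Ω : Type*} [MeasurableSpace Ω] {P : Measure Ω}
    [IsProbabilityMeasure P] {B : ℝ → Ω → ℝ} {H : ℝ} (hH : 0 < H) (hB : IsFBM P B H)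
    (hcont : ∀ ω, ContinuousOn (fun t => B t ω) (Set.Ici 0)) {lam v : ℝ} (hlam : 0 ≤ lam)
    (hv : 0 < v) :
    Real.exp (-lam * v) *
        ((Real.sqrt (2 * π))⁻¹ * Real.exp (-((Real.sqrt v)⁻¹ + 1) ^ 2 / 2)) ≤
      ∫ ω, (if ({t : ℝ | 0 ≤ t ∧ B t ω = 1}).Nonempty
        then Real.exp (-lam * (sInf {t : ℝ | 0 ≤ t ∧ B t ω = 1}) ^ (2 * H)) else 0) ∂P := by
  set t : ℝ := v ^ ((2 * H)⁻¹) with ht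
  have ht0 : 0 < t := by positivity
  have htH : t ^ (2 * H) = v := Real.rpow_inv_rpow hv.le (by positivity)
  have hmap := fbm_map_eval hH hB ht0.le
  rw [htH] at hmap
  have hmeas : MeasurableSet {ω | 1 ≤ B t ω} := measurableSet_le measurable_const (hB.1 t)
  calc _ ≤ Real.exp (-lam * v) * P.real {ω | 1 ≤ B t ω} := by
        gcongr
        exact le_measure_ge_of_map_gaussianReal (hB.1 t) hmap hv
    _ = ∫ ω, Set.indicator {ω | 1 ≤ B t ω} (fun _ => Real.exp (-lam * v)) ω ∂P := by
        rw [integral_indicator_const _ hmeas, smul_eq_mul, mul_comm]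
    _ ≤ _ := by
        refine integral_mono_ae ((integrable_const _).indicator hmeas)
          (integrable_laplace_hittingTime hB.1 hcont hlam) ?_
        filter_upwards [fbm_zero_ae hH hB] with ω h0
        by_cases hω : 1 ≤ B t ω
        · obtain ⟨s, hs, hsB⟩ := intermediate_value_Icc ht0.le
            ((hcont ω).mono fun s hs => hs.1) (show (1 : ℝ) ∈ Set.Icc (B 0 ω) (B t ω) by
              rw [h0]
              exact ⟨zero_le_one, hω⟩)
          have hne : ({t : ℝ | 0 ≤ t ∧ B t ω = 1}).Nonempty := ⟨s, hs.1, hsB⟩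
          rw [Set.indicator_of_mem (by exact hω), if_pos hne]
          rw [Real.exp_le_exp, neg_mul, neg_mul, neg_le_neg_iff]
          gcongr
          rw [← htH]
          have hspec := hittingTime_spec (hcont ω) hne
          exact Real.rpow_le_rpow hspec.1
            ((hittingTime_le (f := fun t => B t ω) hs.1 hsB).trans hs.2) (by positivity)
        · rw [Set.indicator_of_notMem (by exact hω)]
          split_ifs <;> positivity

lemma exp_neg_mul_le_exp_floor {lam r y : ℝ} (hlam : 0 ≤ lam) (hy : 0 < y) :
    Real.exp (-lam * y) ≤ Real.exp (-r * Real.sqrt (2 * lam)) *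
      Real.exp (r ^ 2 / 2 * (⌊y⁻¹⌋₊ + 1)) := by
  rw [← Real.exp_add, Real.exp_le_exp]
  have h1 : y⁻¹ < ⌊y⁻¹⌋₊ + 1 := Nat.lt_floor_add_one _
  have h2 : r ^ 2 / 2 * y⁻¹ ≤ r ^ 2 / 2 * (⌊y⁻¹⌋₊ + 1) := by gcongr
  have h3 : Real.sqrt (2 * lam) ^ 2 = 2 * lam := Real.sq_sqrt (by positivity)
  have h4 : 0 ≤ (Real.sqrt (2 * lam) * y - r) ^ 2 * (y⁻¹ / 2) := by positivity
  have h5 : (Real.sqrt (2 * lam) * y - r) ^ 2 * (y⁻¹ / 2)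
      = Real.sqrt (2 * lam) ^ 2 / 2 * y - r * Real.sqrt (2 * lam) + r ^ 2 / 2 * y⁻¹ := by
    field_simp
    ring
  rw [h5, h3] at h4
  linarith

lemma fbm_exists_laplace_hittingTime_le {Ω : Type*} [MeasurableSpace Ω] {P : Measure Ω}
    [IsProbabilityMeasure P] {B : ℝ → Ω → ℝ} {H : ℝ} (hH : 1 / 2 < H) (hB : IsFBM P B H)
    (hcont : ∀ ω, ContinuousOn (fun t => B t ω) (Set.Ici 0)) {r : ℝ} (hr0 : 0 ≤ r) (hr : r < 1) :
    ∃ K : ℝ, ∀ lam : ℝ, 0 ≤ lam →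
      ∫ ω, (if ({t : ℝ | 0 ≤ t ∧ B t ω = 1}).Nonempty
        then Real.exp (-lam * (sInf {t : ℝ | 0 ≤ t ∧ B t ω = 1}) ^ (2 * H)) else 0) ∂P
        ≤ Real.exp (-r * Real.sqrt (2 * lam)) * K := by
  set q : ℝ := (r + 1) / 2 with hq
  obtain ⟨C, hC, hle⟩ := fbm_exists_measure_hit_nat_le hH hB hcont
    (show 0 ≤ q by linarith) (show q < 1 by linarith)
  set D : ℕ → Set Ω := fun j => {ω | ∃ s : ℝ, 0 ≤ s ∧ j * s ^ (2 * H) ≤ 1 ∧ B s ω = 1} with hD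
  set w : ℕ → ENNReal := fun j => ENNReal.ofReal (Real.exp (r ^ 2 / 2 * (j + 1))) with hw
  have hK : ∑' j, w j * P (D j) ≠ ⊤ := by
    have hsum : Summable fun j : ℕ =>
        Real.exp (r ^ 2 / 2) * Real.exp (r ^ 2 / 2 - q ^ 2 / 2) ^ j := by
      refine (summable_geometric_of_lt_one (by positivity) ?_).mul_left _
      rw [Real.exp_lt_one_iff]
      nlinarith
    refine ne_top_of_le_ne_top (ENNReal.mul_ne_top hC hsum.tsum_ofReal_ne_top) ?_
    rw [← ENNReal.tsum_mul_left]
    refine ENNReal.tsum_le_tsum fun j => ?_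
    refine (mul_le_mul_right (hle j) _).trans (le_of_eq ?_)
    rw [mul_left_comm, ← ENNReal.ofReal_mul (by positivity), ← Real.exp_add, ← Real.exp_nat_mul,
      ← Real.exp_add]
    congr 3
    ring
  refine ⟨(∑' j, w j * P (D j)).toReal, fun lam hlam => ?_⟩
  rw [integral_eq_lintegral_of_nonneg_ae (ae_of_all _ fun ω => by
      simp only [Pi.zero_apply]; split_ifs <;> positivity)
    (measurable_laplace_hittingTime hB.1 hcont lam).aestronglyMeasurable]
  refine ENNReal.toReal_le_of_le_ofReal (by positivity) ?_
  rw [ENNReal.ofReal_mul (by positivity), ENNReal.ofReal_toReal hK]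
  calc _ ≤ ∫⁻ ω, ENNReal.ofReal (Real.exp (-r * Real.sqrt (2 * lam))) *
        ∑' j, Set.indicator (toMeasurable P (D j)) (fun _ => w j) ω ∂P := by
        refine lintegral_mono_ae ?_
        filter_upwards [fbm_zero_ae (by linarith) hB] with ω h0
        split_ifs with hne
        · obtain ⟨hτ0, hτB⟩ := hittingTime_spec (hcont ω) hne
          set τ := sInf {t : ℝ | 0 ≤ t ∧ B t ω = 1}
          have hτ : 0 < τ := by
            refine hτ0.lt_of_ne fun h => ?_
            rw [← h] at hτB
            linarith
          have hy : 0 < τ ^ (2 * H) := by positivity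
          refine (ENNReal.ofReal_le_ofReal (exp_neg_mul_le_exp_floor (r := r) hlam hy)).trans ?_
          rw [ENNReal.ofReal_mul (by positivity)]
          gcongr
          have hmem : ω ∈ toMeasurable P (D ⌊(τ ^ (2 * H))⁻¹⌋₊) := by
            refine subset_toMeasurable P _ ⟨τ, hτ0, ?_, hτB⟩
            rw [← le_div_iff₀ hy, one_div]
            exact Nat.floor_le (by positivity)
          refine le_trans (le_of_eq ?_) (ENNReal.le_tsum ⌊(τ ^ (2 * H))⁻¹⌋₊)
          rw [Set.indicator_of_mem hmem]
        · simp
    _ = _ := by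
        have hmeas : ∀ j, Measurable (Set.indicator (toMeasurable P (D j)) fun _ => w j) :=
          fun j => measurable_const.indicator (measurableSet_toMeasurable _ _)
        rw [lintegral_const_mul _ (Measurable.tsum hmeas),
          lintegral_tsum fun j => (hmeas j).aemeasurable]
        congr 2
        funext j
        rw [lintegral_indicator_const (measurableSet_toMeasurable _ _), measure_toMeasurable]

lemma tendsto_neg_log_div_of_bounds {ι : Type*} {l : Filter ι} {E s : ι → ℝ} {c : ℝ}
    (hs : Tendsto s l atTop) (hc : 0 < c)
    (hlo : ∀ᶠ i in l, c * Real.exp (-(s i + Real.sqrt (s i))) ≤ E i)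
    (hup : ∀ r : ℝ, 0 ≤ r → r < 1 → ∃ K : ℝ, ∀ᶠ i in l, E i ≤ Real.exp (-r * s i) * K) :
    Tendsto (fun i => -Real.log (E i) / s i) l (nhds 1) := by
  have hinv : Tendsto (fun i => (s i)⁻¹) l (nhds 0) := tendsto_inv_atTop_zero.comp hs
  have hsinv : Tendsto (fun i => (Real.sqrt (s i))⁻¹) l (nhds 0) :=
    tendsto_inv_atTop_zero.comp (Real.tendsto_sqrt_atTop.comp hs)
  refine tendsto_order.2 ⟨fun a ha => ?_, fun a ha => ?_⟩
  · obtain ⟨r, hr, hr1⟩ := exists_between (max_lt ha one_pos)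
    obtain ⟨K, hK⟩ := hup r ((le_max_right _ _).trans hr.le) hr1
    have hlim : Tendsto (fun i => r - Real.log K * (s i)⁻¹) l (nhds (r - Real.log K * 0)) :=
      tendsto_const_nhds.sub (hinv.const_mul _)
    rw [mul_zero, sub_zero] at hlim
    filter_upwards [hlim.eventually_const_lt ((le_max_left a 0).trans_lt hr), hK, hlo,
      hs.eventually_gt_atTop 0] with i h1 h2 h3 h4
    have hE : 0 < E i := lt_of_lt_of_le (by positivity) h3
    have hKpos : 0 < K := (mul_pos_iff_of_pos_left (Real.exp_pos _)).1 (hE.trans_le h2)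
    have h5 := Real.log_le_log hE h2
    rw [Real.log_mul (by positivity) hKpos.ne', Real.log_exp] at h5
    refine h1.trans_le ((le_div_iff₀ h4).2 ?_)
    rw [sub_mul, mul_assoc, inv_mul_cancel₀ h4.ne']
    linarith
  · have hlim : Tendsto (fun i => 1 + (Real.sqrt (s i))⁻¹ - Real.log c * (s i)⁻¹) l
        (nhds (1 + 0 - Real.log c * 0)) :=
      (tendsto_const_nhds.add hsinv).sub (hinv.const_mul _)
    rw [mul_zero, sub_zero, add_zero] at hlim
    filter_upwards [hlim.eventually_lt_const ha, hlo, hs.eventually_gt_atTop 0] with i h1 h3 h4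
    have h5 := Real.log_le_log (by positivity) h3
    rw [Real.log_mul hc.ne' (Real.exp_pos _).ne', Real.log_exp] at h5
    refine lt_of_le_of_lt ((div_le_iff₀ h4).2 ?_) h1
    have h6 : (Real.sqrt (s i))⁻¹ * s i = Real.sqrt (s i) := by
      nth_rewrite 2 [← Real.mul_self_sqrt h4.le]
      rw [inv_mul_cancel_left₀ (Real.sqrt_pos.2 h4).ne']
    rw [sub_mul, add_mul, mul_assoc, inv_mul_cancel₀ h4.ne', h6]
    linarith

/-- Let `τ_H` be the first hitting time of `1` by a fractional Brownian motion started at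
`0`, with `H ∈ (1/2,1)`. Then `-log E[exp(-λ τ_H^{2H})] ~ √(2λ)` as `λ → ∞`, i.e. the
ratio tends to `1`. -/
theorem fbm_hitting_time_laplace_asymptotic
    {Ω : Type*} [MeasurableSpace Ω] (P : Measure Ω) [IsProbabilityMeasure P]
    (B : ℝ → Ω → ℝ) (H : ℝ) (hH : H ∈ Set.Ioo (1/2 : ℝ) 1)
    (hB : IsFBM P B H) (hcont : ∀ ω, ContinuousOn (fun t => B t ω) (Set.Ici 0)) :
    Tendsto (fun lam : ℝ =>
        (-Real.log (∫ ω, (if ({t : ℝ | 0 ≤ t ∧ B t ω = 1}).Nonempty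
            then Real.exp (-lam * (sInf {t : ℝ | 0 ≤ t ∧ B t ω = 1}) ^ (2*H)) else 0) ∂P))
          / Real.sqrt (2*lam))
      atTop (nhds 1) := by
  have hs : Tendsto (fun lam : ℝ => Real.sqrt (2 * lam)) atTop atTop :=
    Real.tendsto_sqrt_atTop.comp (tendsto_id.const_mul_atTop two_pos)
  refine tendsto_neg_log_div_of_bounds (c := (Real.sqrt (2 * π))⁻¹ * Real.exp (-(1 / 2))) hs
    (by positivity) ?_ fun r hr0 hr1 => ?_
  · filter_upwards [eventually_gt_atTop 0] with lam hlam
    have hs0 : 0 < Real.sqrt (2 * lam) := by positivity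
    refine le_trans (le_of_eq ?_) (fbm_le_laplace_hittingTime (by linarith [hH.1]) hB hcont hlam.le
      (inv_pos.2 hs0))
    rw [Real.sqrt_inv, inv_inv, mul_left_comm (Real.exp _), mul_assoc, ← Real.exp_add,
      ← Real.exp_add]
    congr 2
    have h1 : lam * (Real.sqrt (2 * lam))⁻¹ = Real.sqrt (2 * lam) / 2 := by
      have h2 : Real.sqrt (2 * lam) ^ 2 = 2 * lam := Real.sq_sqrt (by positivity)
      field_simp
      rw [mul_comm 2 lam] at h2
      exact h2.symm
    have h3 : Real.sqrt (Real.sqrt (2 * lam)) ^ 2 = Real.sqrt (2 * lam) := Real.sq_sqrt hs0.le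
    rw [neg_mul, h1]
    nlinarith
  · obtain ⟨K, hK⟩ := fbm_exists_laplace_hittingTime_le hH.1 hB hcont hr0 hr1
    exact ⟨K, (eventually_ge_atTop 0).mono hK⟩
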